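/- Let p be a prime, x ∈ ℚ_p nonzero with v_p(x) < 0, and e ∈ ℤ with e > v_p(x). Then the p-adic ball B(x, p^{-e}) is μ-measurable with height measure μ(B(x, p^{-e})) = p^{1-e}/(|x|_p^2 (p+1)) = p^{1 + 2 v_p(x) - e}/(p+1); that is, the ratio #{r ∈ ℚ : H(r) ≤ T and |r − x|_p ≤ p^{-e}} / #{r ∈ ℚ : H(r) ≤ T} tends to p^{1 + 2 v_p(x) - e}/(p+1) as T → ∞. -/

import Mathlib

/-- The height of a rational number: for `r = m/n` in lowest terms,
`H(r) = max (|m|, n)`; in particular `H(0) = 1`. -/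
def ratHeight (r : ℚ) : ℕ := max r.num.natAbs r.den

open Filter Topology
open scoped ArithmeticFunction.Moebius

open Classical in
/-- The pairs `(m, n)` satisfying `P` with `|m| ≤ T` and `1 ≤ n ≤ T / K`. -/
noncomputable def boxFilter (P : ℤ → ℕ → Prop) (K T : ℕ) : Finset (ℤ × ℕ) :=
  (Finset.Icc (-(T : ℤ)) T ×ˢ Finset.Icc 1 (T / K)).filter (fun z => P z.1 z.2)

theorem mem_boxFilter {P : ℤ → ℕ → Prop} {K T : ℕ} {z : ℤ × ℕ} :
    z ∈ boxFilter P K T ↔ (z.1.natAbs ≤ T ∧ 1 ≤ z.2 ∧ z.2 ≤ T / K) ∧ P z.1 z.2 := by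
  simp only [boxFilter, Finset.mem_filter, Finset.mem_product, Finset.mem_Icc]
  refine and_congr_left fun _ => and_congr_left fun _ => ?_
  omega

theorem card_boxFilter_le (P : ℤ → ℕ → Prop) (K T : ℕ) :
    ((boxFilter P K T).card : ℝ) ≤ 3 * (T : ℝ) ^ 2 := by
  have h : (boxFilter P K T).card ≤ 3 * T ^ 2 := by
    classical
    rw [boxFilter]
    refine (Finset.card_filter_le _ _).trans ?_
    rw [Finset.card_product, Int.card_Icc, Nat.card_Icc]
    have h1 : ((T : ℤ) + 1 - -(T : ℤ)).toNat = 2 * T + 1 := by omega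
    rw [h1, Nat.add_sub_cancel]
    refine (Nat.mul_le_mul_left _ (Nat.div_le_self T K)).trans ?_
    nlinarith [Nat.le_self_pow (two_ne_zero) T]
  exact_mod_cast h

theorem boxFilter_zero (P : ℤ → ℕ → Prop) (K : ℕ) : boxFilter P K 0 = ∅ := by
  ext z
  rw [mem_boxFilter]
  simp
  omega

/-- Scaling by `d` identifies the pairs in the box of size `T / d` with the pairs in the box of
size `T` whose entries are both divisible by `d`. -/
theorem card_boxFilter_dvd (P : ℤ → ℕ → Prop) (K T d : ℕ) (hd : 0 < d) (c : Prop) [Decidable c]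
    (hP : ∀ m n, P (d * m) (d * n) ↔ c ∧ P m n) :
    ((boxFilter P K T).filter (fun z => d ∣ z.1.gcd z.2)).card =
      if c then (boxFilter P K (T / d)).card else 0 := by
  have hiff : ∀ z : ℤ × ℕ, (d ∣ z.1.gcd z.2) ↔ ∃ m n, z = ((d : ℤ) * m, d * n) := by
    rintro ⟨a, b⟩
    rw [Int.dvd_gcd_iff]
    constructor
    · rintro ⟨⟨m, rfl⟩, ⟨n, hn⟩⟩
      have : d ∣ b := by exact_mod_cast Dvd.intro n hn.symm
      obtain ⟨n, rfl⟩ := this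
      exact ⟨m, n, rfl⟩
    · rintro ⟨m, n, h⟩
      simp only [Prod.mk.injEq] at h
      obtain ⟨rfl, rfl⟩ := h
      simp
  have hmem : ∀ m n, ((d : ℤ) * m, d * n) ∈ boxFilter P K T ↔
      c ∧ (m, n) ∈ boxFilter P K (T / d) := by
    intro m n
    simp only [mem_boxFilter, hP, Int.natAbs_mul, Int.natAbs_natCast]
    have h1 : d * m.natAbs ≤ T ↔ m.natAbs ≤ T / d := by
      rw [Nat.le_div_iff_mul_le hd, mul_comm]
    have h2 : d * n ≤ T / K ↔ n ≤ T / d / K := by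
      rw [Nat.div_div_eq_div_mul, mul_comm d K, ← Nat.div_div_eq_div_mul,
        Nat.le_div_iff_mul_le hd, mul_comm]
    have h3 : 1 ≤ d * n ↔ 1 ≤ n := by
      simp only [Nat.one_le_iff_ne_zero]
      simp [hd.ne']
    rw [h1, h2, h3]
    tauto
  split_ifs with hc
  · symm
    refine Finset.card_bij (fun z _ => ((d : ℤ) * z.1, d * z.2)) ?_ ?_ ?_
    · rintro ⟨m, n⟩ hz
      rw [Finset.mem_filter]
      exact ⟨(hmem m n).2 ⟨hc, hz⟩, (hiff _).2 ⟨m, n, rfl⟩⟩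
    · rintro ⟨m, n⟩ _ ⟨m', n'⟩ _ h
      simpa [hd.ne'] using h
    · intro z hz
      rw [Finset.mem_filter, hiff] at hz
      obtain ⟨hz, m, n, rfl⟩ := hz
      exact ⟨(m, n), ((hmem m n).1 hz).2, rfl⟩
  · rw [Finset.card_eq_zero, Finset.filter_eq_empty_iff]
    intro z hz hdz
    obtain ⟨m, n, rfl⟩ := (hiff z).1 hdz
    exact hc ((hmem m n).1 hz).1

theorem sum_moebius_dvd (g T : ℕ) (hg : 0 < g) (hT : g ≤ T) :
    ∑ d ∈ Finset.Icc 1 T, (if d ∣ g then μ d else 0) = if g = 1 then 1 else 0 := by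
  rw [← Finset.sum_filter]
  have h : (Finset.Icc 1 T).filter (fun d => d ∣ g) = g.divisors := by
    ext d
    simp only [Finset.mem_filter, Finset.mem_Icc, Nat.mem_divisors]
    constructor
    · rintro ⟨_, h⟩
      exact ⟨h, hg.ne'⟩
    · rintro ⟨h, _⟩
      exact ⟨⟨Nat.pos_of_dvd_of_pos h hg, (Nat.le_of_dvd hg h).trans hT⟩, h⟩
  rw [h, ← ArithmeticFunction.coe_mul_zeta_apply, ArithmeticFunction.moebius_mul_coe_zeta,
    ArithmeticFunction.one_apply]

/-- Möbius inversion for the number of coprime pairs in a box. -/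
theorem card_boxFilter_coprime (P : ℤ → ℕ → Prop) (K T : ℕ) (χ : ℕ → Prop) [DecidablePred χ]
    (hP : ∀ d : ℕ, 0 < d → ∀ m n, P (d * m) (d * n) ↔ χ d ∧ P m n) :
    ((boxFilter (fun m n => P m n ∧ m.gcd n = 1) K T).card : ℤ) =
      ∑ d ∈ Finset.Icc 1 T, if χ d then μ d * (boxFilter P K (T / d)).card else 0 := by
  have h1 : boxFilter (fun m n => P m n ∧ m.gcd n = 1) K T =
      (boxFilter P K T).filter (fun z => z.1.gcd z.2 = 1) := by
    ext z
    simp only [Finset.mem_filter, mem_boxFilter, and_assoc]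
  have h2 : ∀ z ∈ boxFilter P K T, (if z.1.gcd z.2 = 1 then (1 : ℤ) else 0) =
      ∑ d ∈ Finset.Icc 1 T, (if d ∣ z.1.gcd z.2 then μ d else 0) := by
    intro z hz
    rw [mem_boxFilter] at hz
    have hn : 0 < z.2 := hz.1.2.1
    refine (sum_moebius_dvd _ _ ?_ ?_).symm
    · exact Int.gcd_pos_of_ne_zero_right _ (by exact_mod_cast hn.ne')
    · have : z.1.gcd z.2 ∣ z.2 := by
        have := Int.gcd_dvd_right z.1 (z.2 : ℤ)
        exact_mod_cast this
      exact (Nat.le_of_dvd hn this).trans (hz.1.2.2.trans (Nat.div_le_self _ _))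
  rw [h1, Finset.card_filter, Nat.cast_sum]
  simp only [Nat.cast_ite, Nat.cast_one, Nat.cast_zero]
  rw [Finset.sum_congr rfl h2, Finset.sum_comm]
  refine Finset.sum_congr rfl fun d hd => ?_
  have hd0 : 0 < d := (Finset.mem_Icc.1 hd).1
  rw [← Finset.sum_filter, Finset.sum_const, card_boxFilter_dvd P K T d hd0 (χ d) (hP d hd0)]
  split_ifs <;> simp [mul_comm]

theorem tendsto_natDiv_div (d : ℕ) :
    Tendsto (fun T : ℕ => ((T / d : ℕ) : ℝ) / T) atTop (𝓝 ((d : ℝ)⁻¹)) := by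
  have h := (tendsto_nat_floor_mul_div_atTop (R := ℝ) (a := (d : ℝ)⁻¹) (by positivity)).comp
    tendsto_natCast_atTop_atTop
  refine h.congr fun T => ?_
  simp only [Function.comp]
  rw [← Nat.floor_div_eq_div (K := ℝ), div_eq_inv_mul (T : ℝ) (d : ℝ)]

theorem tendsto_card_boxFilter_coprime (P : ℤ → ℕ → Prop) (K : ℕ) (χ : ℕ → Prop)
    [DecidablePred χ] (hP : ∀ d : ℕ, 0 < d → ∀ m n, P (d * m) (d * n) ↔ χ d ∧ P m n) (c : ℝ)
    (hc : Tendsto (fun T : ℕ => ((boxFilter P K T).card : ℝ) / (T : ℝ) ^ 2) atTop (𝓝 c)) :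
    Tendsto (fun T : ℕ =>
        ((boxFilter (fun m n => P m n ∧ m.gcd n = 1) K T).card : ℝ) / (T : ℝ) ^ 2) atTop
      (𝓝 (c * ∑' d : ℕ, if χ d then (μ d : ℝ) / (d : ℝ) ^ 2 else 0)) := by
  have key : ∀ T : ℕ,
      ((boxFilter (fun m n => P m n ∧ m.gcd n = 1) K T).card : ℝ) / (T : ℝ) ^ 2 =
      ∑' d : ℕ, if χ d then (μ d : ℝ) * ((boxFilter P K (T / d)).card / (T : ℝ) ^ 2) else 0 := by
    intro T
    have h := congrArg (Int.cast : ℤ → ℝ) (card_boxFilter_coprime P K T χ hP)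
    push_cast at h
    rw [h, Finset.sum_div, tsum_eq_sum (s := Finset.Icc 1 T)]
    · refine Finset.sum_congr rfl fun d _ => ?_
      split_ifs
      · ring
      · simp
    · intro d hd
      have : T / d = 0 := by
        rw [Finset.mem_Icc] at hd
        rcases Nat.eq_zero_or_pos d with rfl | h
        · simp
        · exact Nat.div_eq_of_lt (by omega)
      simp [this, boxFilter_zero]
  simp_rw [key]
  rw [← tsum_mul_left]
  refine tendsto_tsum_of_dominated_convergence (bound := fun d : ℕ => 3 * (1 / (d : ℝ) ^ 2))
    ((Real.summable_one_div_nat_pow.2 one_lt_two).mul_left 3) ?_ ?_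
  · intro d
    split_ifs
    · rcases Nat.eq_zero_or_pos d with rfl | hd
      · simp
      have h1 := hc.comp (Nat.tendsto_div_const_atTop hd.ne')
      have h2 := (h1.mul ((tendsto_natDiv_div d).pow 2)).const_mul (μ d : ℝ)
      have e : (μ d : ℝ) * (c * ((d : ℝ)⁻¹) ^ 2) = c * ((μ d : ℝ) / (d : ℝ) ^ 2) := by
        field_simp
      rw [e] at h2
      refine h2.congr' ?_
      filter_upwards [eventually_ge_atTop d] with T hT
      have h3 : ((T / d : ℕ) : ℝ) ≠ 0 := by
        have := Nat.div_pos hT hd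
        exact_mod_cast this.ne'
      simp only [Function.comp]
      field_simp
    · simp
  · refine Eventually.of_forall fun T d => ?_
    have hb : (0 : ℝ) ≤ 3 * (1 / (d : ℝ) ^ 2) := by positivity
    split_ifs
    · have hmu : |(μ d : ℝ)| ≤ 1 := by exact_mod_cast ArithmeticFunction.abs_moebius_le_one
      rw [Real.norm_eq_abs, abs_mul,
        abs_of_nonneg (a := ((boxFilter P K (T / d)).card / (T : ℝ) ^ 2)) (by positivity)]
      refine (mul_le_of_le_one_left (by positivity) hmu).trans ?_
      rcases Nat.eq_zero_or_pos T with rfl | hT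
      · simp
      have h1 := card_boxFilter_le P K (T / d)
      have h2 : ((T / d : ℕ) : ℝ) ≤ T / d := Nat.cast_div_le
      have h3 : ((T / d : ℕ) : ℝ) ^ 2 ≤ (T / d : ℝ) ^ 2 := by gcongr
      have hT' : (0 : ℝ) < T := by exact_mod_cast hT
      rw [div_le_iff₀ (by positivity)]
      calc _ ≤ 3 * (T / d : ℝ) ^ 2 := by linarith
        _ = _ := by ring
    · rwa [norm_zero]

theorem summable_moebius_div_sq (χ : ℕ → Prop) [DecidablePred χ] :
    Summable (fun d : ℕ => if χ d then (μ d : ℝ) / (d : ℝ) ^ 2 else 0) := by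
  refine Summable.of_norm_bounded (Real.summable_one_div_nat_pow.2 one_lt_two) fun d => ?_
  split_ifs
  · have hmu : |(μ d : ℝ)| ≤ 1 := by exact_mod_cast ArithmeticFunction.abs_moebius_le_one
    rw [Real.norm_eq_abs, abs_div, abs_of_nonneg (a := (d : ℝ) ^ 2) (by positivity)]
    gcongr
  · simp

theorem tsum_moebius_div_sq_ne_zero : ∑' d : ℕ, (μ d : ℝ) / (d : ℝ) ^ 2 ≠ 0 := by
  intro h
  have h2 : (1 : ℝ) < (2 : ℂ).re := by norm_num
  have h1 := ArithmeticFunction.LSeries_zeta_mul_Lseries_moebius h2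
  have h3 : LSeries (fun n => ((μ n : ℤ) : ℂ)) 2 =
      ((∑' d : ℕ, (μ d : ℝ) / (d : ℝ) ^ 2 : ℝ) : ℂ) := by
    rw [Complex.ofReal_tsum, LSeries]
    refine tsum_congr fun d => ?_
    rcases Nat.eq_zero_or_pos d with rfl | hd
    · simp
    · rw [LSeries.term_of_ne_zero hd.ne']
      push_cast
      norm_cast
  rw [h3, h] at h1
  simp at h1

theorem moebius_prime_mul (p : ℕ) (hp : p.Prime) (j : ℕ) :
    μ (p * j) = if ¬ p ∣ j then -μ j else 0 := by
  by_cases h : p ∣ j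
  · rw [if_neg (not_not.2 h)]
    refine ArithmeticFunction.moebius_eq_zero_of_not_squarefree fun hs => ?_
    obtain ⟨k, rfl⟩ := h
    have := hs p ⟨k, by ring⟩
    exact hp.one_lt.ne' (Nat.isUnit_iff.1 this)
  · rw [if_pos h, ArithmeticFunction.isMultiplicative_moebius.map_mul_of_coprime
      ((Nat.Prime.coprime_iff_not_dvd hp).2 h), ArithmeticFunction.moebius_apply_prime hp]
    ring

/-- Removing the Euler factor at `p` from `∑ μ(d) / d²`. -/
theorem tsum_moebius_div_sq_eq (p : ℕ) (hp : p.Prime) :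
    ∑' d : ℕ, (μ d : ℝ) / (d : ℝ) ^ 2 =
      (1 - 1 / (p : ℝ) ^ 2) * ∑' d : ℕ, if ¬ p ∣ d then (μ d : ℝ) / (d : ℝ) ^ 2 else 0 := by
  have h1 : ∀ d : ℕ, (μ d : ℝ) / (d : ℝ) ^ 2 =
      (if ¬ p ∣ d then (μ d : ℝ) / (d : ℝ) ^ 2 else 0) +
        (if p ∣ d then (μ d : ℝ) / (d : ℝ) ^ 2 else 0) := by
    intro d
    by_cases h : p ∣ d <;> simp [h]
  have h2 : ∑' d : ℕ, (if p ∣ d then (μ d : ℝ) / (d : ℝ) ^ 2 else 0) =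
      ∑' j : ℕ, -(1 / (p : ℝ) ^ 2) * (if ¬ p ∣ j then (μ j : ℝ) / (j : ℝ) ^ 2 else 0) := by
    have hinj : Function.Injective (fun j : ℕ => p * j) :=
      fun a b h => Nat.eq_of_mul_eq_mul_left hp.pos h
    rw [← hinj.tsum_eq]
    · refine tsum_congr fun j => ?_
      simp only [dvd_mul_right, if_true, moebius_prime_mul p hp]
      by_cases h : p ∣ j
      · simp [h]
      · rw [if_pos h, if_pos h]
        push_cast
        rw [mul_pow, neg_div, neg_mul, div_mul_div_comm, one_mul]
    · intro d hd
      by_contra hn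
      refine hd (if_neg ?_)
      rintro ⟨j, rfl⟩
      exact hn ⟨j, rfl⟩
  rw [tsum_congr h1, (summable_moebius_div_sq _).tsum_add (summable_moebius_div_sq _), h2,
    tsum_mul_left]
  ring

theorem abs_card_filter_modEq_sub_le (T : ℕ) (v r : ℤ) (hr : 0 < r) :
    |(((Finset.Icc (-(T : ℤ)) T).filter (fun m => m ≡ v [ZMOD r])).card : ℝ) - 2 * T / r| ≤ 2 := by
  have h1 : Finset.Icc (-(T : ℤ)) T = Finset.Ioc (-(T : ℤ) - 1) T := by
    ext m
    simp only [Finset.mem_Icc, Finset.mem_Ioc]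
    omega
  have h2 := Int.Ioc_filter_modEq_card (-(T : ℤ) - 1) T hr v
  rw [← h1] at h2
  set c := ((Finset.Icc (-(T : ℤ)) T).filter (fun m => m ≡ v [ZMOD r])).card
  have hr0 : (0 : ℚ) < r := by exact_mod_cast hr
  have hr1 : (1 : ℚ) ≤ r := by exact_mod_cast hr
  have hmono : ⌊(((-(T : ℤ) - 1 : ℤ) : ℚ) - v) / (r : ℚ)⌋ ≤ ⌊(((T : ℤ) : ℚ) - v) / (r : ℚ)⌋ := by
    apply Int.floor_le_floor
    gcongr
    omega
  rw [max_eq_left (by omega)] at h2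
  have h3 := Int.floor_le ((((-(T : ℤ) - 1 : ℤ) : ℚ) - v) / (r : ℚ))
  have h4 := Int.lt_floor_add_one ((((-(T : ℤ) - 1 : ℤ) : ℚ) - v) / (r : ℚ))
  have h5 := Int.floor_le ((((T : ℤ) : ℚ) - v) / (r : ℚ))
  have h6 := Int.lt_floor_add_one ((((T : ℤ) : ℚ) - v) / (r : ℚ))
  have h7 : (c : ℚ) = (⌊(((T : ℤ) : ℚ) - v) / (r : ℚ)⌋ : ℚ) -
      ⌊(((-(T : ℤ) - 1 : ℤ) : ℚ) - v) / (r : ℚ)⌋ := by exact_mod_cast h2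
  have h8 : (((T : ℤ) : ℚ) - v) / (r : ℚ) - (((-(T : ℤ) - 1 : ℤ) : ℚ) - v) / (r : ℚ) =
      2 * T / r + 1 / r := by
    push_cast
    field_simp
    ring
  have h9 : 1 / (r : ℚ) ≤ 1 := (div_le_one hr0).2 hr1
  have h10 : 0 ≤ 1 / (r : ℚ) := by positivity
  have h11 : |(c : ℚ) - 2 * T / r| ≤ 2 := by
    rw [abs_le]
    constructor <;> linarith
  exact_mod_cast h11

theorem card_filter_not_dvd (p M : ℕ) :
    (((Finset.Icc 1 M).filter (fun n => ¬ p ∣ n)).card : ℝ) = (M : ℝ) - (M / p : ℕ) := by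
  have h := Finset.card_filter_add_card_filter_not (s := Finset.Icc 1 M) (fun n => p ∣ n)
  have h2 : ((Finset.Icc 1 M).filter (fun n => p ∣ n)).card = M / p :=
    Nat.Ioc_filter_dvd_card_eq_div M p
  rw [h2, Nat.card_Icc, Nat.add_sub_cancel] at h
  rw [eq_sub_iff_add_eq']
  exact_mod_cast h

theorem abs_card_boxFilter_modEq_sub_le (p K T q : ℕ) (hq : 0 < q) (a : ℕ) :
    |((boxFilter (fun m n => ¬ p ∣ n ∧ m ≡ a * n [ZMOD q]) K T).card : ℝ) -
      (((T / K : ℕ) : ℝ) - (T / K / p : ℕ)) * (2 * T / q)| ≤ 2 * T := by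
  have h1 : (boxFilter (fun m n => ¬ p ∣ n ∧ m ≡ a * n [ZMOD q]) K T).card =
      ∑ n ∈ (Finset.Icc 1 (T / K)).filter (fun n => ¬ p ∣ n),
        ((Finset.Icc (-(T : ℤ)) T).filter (fun m => m ≡ a * n [ZMOD q])).card := by
    rw [boxFilter, Finset.card_filter, Finset.sum_product_right, Finset.sum_filter]
    refine Finset.sum_congr rfl fun n _ => ?_
    by_cases h : p ∣ n
    · simp [h]
    · simp only [h, not_false_eq_true, true_and, if_true, Finset.card_filter]
  rw [h1, ← card_filter_not_dvd, ← nsmul_eq_mul, ← Finset.sum_const, Nat.cast_sum,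
    ← Finset.sum_sub_distrib]
  refine (Finset.abs_sum_le_sum_abs _ _).trans ?_
  refine (Finset.sum_le_card_nsmul _ _ 2 fun n _ => ?_).trans ?_
  · have h := abs_card_filter_modEq_sub_le T (a * n) q (by exact_mod_cast hq)
    rwa [Int.cast_natCast] at h
  · have h2 : ((Finset.Icc 1 (T / K)).filter (fun n => ¬ p ∣ n)).card ≤ T := by
      refine (Finset.card_filter_le _ _).trans ?_
      rw [Nat.card_Icc, Nat.add_sub_cancel]
      exact Nat.div_le_self _ _
    rw [nsmul_eq_mul, mul_comm]
    gcongr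

theorem tendsto_card_boxFilter_modEq (p K q : ℕ) (hq : 0 < q) (a : ℕ) :
    Tendsto (fun T : ℕ =>
      ((boxFilter (fun m n => ¬ p ∣ n ∧ m ≡ a * n [ZMOD q]) K T).card : ℝ) / (T : ℝ) ^ 2) atTop
      (𝓝 (((K : ℝ)⁻¹ - ((K * p : ℕ) : ℝ)⁻¹) * (2 / q))) := by
  have h1 : Tendsto (fun T : ℕ => (((T / K : ℕ) : ℝ) / T - ((T / (K * p) : ℕ) : ℝ) / T) *
      (2 / (q : ℝ))) atTop (𝓝 (((K : ℝ)⁻¹ - ((K * p : ℕ) : ℝ)⁻¹) * (2 / q))) :=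
    ((tendsto_natDiv_div K).sub (tendsto_natDiv_div (K * p))).mul_const _
  have h2 : Tendsto (fun T : ℕ =>
      ((boxFilter (fun m n => ¬ p ∣ n ∧ m ≡ a * n [ZMOD q]) K T).card : ℝ) / (T : ℝ) ^ 2 -
      (((T / K : ℕ) : ℝ) / T - ((T / (K * p) : ℕ) : ℝ) / T) * (2 / (q : ℝ))) atTop (𝓝 0) := by
    refine squeeze_zero_norm' ?_ (tendsto_const_div_atTop_nhds_zero_nat 2)
    filter_upwards [eventually_gt_atTop 0] with T hT
    have hT' : (0 : ℝ) < T := by exact_mod_cast hT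
    have h3 := abs_card_boxFilter_modEq_sub_le p K T q hq a
    rw [Nat.div_div_eq_div_mul] at h3
    have h4 : ∀ c A B : ℝ, c / (T : ℝ) ^ 2 - (A / T - B / T) * (2 / (q : ℝ)) =
        (c - (A - B) * (2 * T / q)) / (T : ℝ) ^ 2 := by
      intro c A B
      field_simp
    rw [h4, Real.norm_eq_abs, abs_div, abs_of_nonneg (a := (T : ℝ) ^ 2) (by positivity),
      div_le_div_iff₀ (by positivity) hT']
    nlinarith
  simpa using h2.add h1

theorem tendsto_card_boxFilter_true :
    Tendsto (fun T : ℕ => ((boxFilter (fun _ _ => True) 1 T).card : ℝ) / (T : ℝ) ^ 2) atTop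
      (𝓝 2) := by
  have h1 : Tendsto (fun T : ℕ => (2 : ℝ) + 1 / (T : ℝ)) atTop (𝓝 (2 + 0)) :=
    tendsto_const_nhds.add (tendsto_const_div_atTop_nhds_zero_nat 1)
  rw [add_zero] at h1
  refine h1.congr' ?_
  filter_upwards [eventually_gt_atTop 0] with T hT
  have h2 : (boxFilter (fun _ _ => True) 1 T).card = (2 * T + 1) * T := by
    simp only [boxFilter, Finset.filter_true, Finset.card_product, Int.card_Icc, Nat.card_Icc,
      Nat.div_one, Nat.add_sub_cancel]
    congr 1
    omega
  have hT' : (T : ℝ) ≠ 0 := by exact_mod_cast hT.ne'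
  rw [h2]
  push_cast
  field_simp

/-- Rationals in lowest terms correspond to coprime pairs. -/
theorem card_ratHeight_le (Q : ℚ → Prop) (P : ℤ → ℕ → Prop) (K T : ℕ) (hK : 0 < K)
    (hQ : ∀ r, Q r ↔ ∃ n, r.den = K * n ∧ P r.num n)
    (hP : ∀ m n, P m n → m.gcd n = 1 → m.gcd ((K * n : ℕ) : ℤ) = 1) :
    Nat.card {r : ℚ // ratHeight r ≤ T ∧ Q r} =
      (boxFilter (fun m n => P m n ∧ m.gcd n = 1) K T).card := by
  have hrat : ∀ m n, 0 < n → P m n → m.gcd n = 1 →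
      ((m : ℚ) / ((K * n : ℕ) : ℤ)).num = m ∧ ((m : ℚ) / ((K * n : ℕ) : ℤ)).den = K * n := by
    intro m n hn h hg
    have hpos : (0 : ℤ) < ((K * n : ℕ) : ℤ) := by exact_mod_cast Nat.mul_pos hK hn
    have hc : Nat.Coprime m.natAbs ((K * n : ℕ) : ℤ).natAbs := hP m n h hg
    exact ⟨Rat.num_div_eq_of_coprime hpos hc, by exact_mod_cast Rat.den_div_eq_of_coprime hpos hc⟩
  rw [← Finset.card_image_of_injOn (f := fun z : ℤ × ℕ => (z.1 : ℚ) / ((K * z.2 : ℕ) : ℤ))]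
  · refine Nat.subtype_card _ fun r => ?_
    rw [Finset.mem_image, hQ, ratHeight, max_le_iff]
    constructor
    · rintro ⟨⟨m, n⟩, hz, rfl⟩
      rw [mem_boxFilter] at hz
      obtain ⟨⟨hm, hn1, hn⟩, h, hg⟩ := hz
      obtain ⟨e1, e2⟩ := hrat m n hn1 h hg
      simp only at *
      rw [e1, e2]
      refine ⟨⟨hm, ?_⟩, n, rfl, h⟩
      rwa [mul_comm, ← Nat.le_div_iff_mul_le hK]
    · rintro ⟨⟨hm, hd⟩, n, hn, h⟩
      have hn0 : 0 < n := by
        refine Nat.pos_of_ne_zero ?_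
        rintro rfl
        exact r.den_ne_zero (hn.trans (mul_zero K))
      refine ⟨(r.num, n), ?_, ?_⟩
      · rw [mem_boxFilter]
        refine ⟨⟨hm, hn0, ?_⟩, h, ?_⟩
        · rwa [Nat.le_div_iff_mul_le hK, mul_comm, ← hn]
        · have := r.reduced
          rw [hn] at this
          exact this.coprime_mul_left_right
      · simp only [← hn]
        exact_mod_cast r.num_div_den
  · rintro ⟨m, n⟩ hz ⟨m', n'⟩ hz' heq
    rw [Finset.mem_coe, mem_boxFilter] at hz hz'
    obtain ⟨e1, e2⟩ := hrat m n hz.1.2.1 hz.2.1 hz.2.2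
    obtain ⟨e1', e2'⟩ := hrat m' n' hz'.1.2.1 hz'.2.1 hz'.2.2
    simp only at heq
    rw [heq] at e1 e2
    rw [e1'] at e1
    rw [e2'] at e2
    rw [e1, Nat.eq_of_mul_eq_mul_left hK e2]

/-- For `p ∤ n`, closeness of `m / (pᵏ n)` to `x` is a congruence between `m` and `n`. -/
theorem norm_div_sub_le_iff (p : ℕ) [hp : Fact p.Prime] (x : ℚ_[p]) (k N a : ℕ)
    (ha : ‖(p : ℚ_[p]) ^ k * x - a‖ ≤ (p : ℝ) ^ (-(N : ℤ))) (m : ℤ) (n : ℕ) (hn : ¬ p ∣ n) :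
    ‖(m : ℚ_[p]) / ((p ^ k * n : ℕ) : ℚ_[p]) - x‖ ≤ (p : ℝ) ^ (-((N : ℤ) - k)) ↔
      m ≡ a * n [ZMOD (p ^ N : ℕ)] := by
  have hp0 : (0 : ℝ) < p := by exact_mod_cast hp.out.pos
  have hpp : (p : ℚ_[p]) ≠ 0 := by exact_mod_cast hp.out.ne_zero
  have hn1 : ‖(n : ℚ_[p])‖ = 1 :=
    Padic.norm_natCast_eq_one_iff.2 ((Nat.Prime.coprime_iff_not_dvd hp.out).2 hn)
  have hn0 : (n : ℚ_[p]) ≠ 0 := by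
    intro h
    simp [h] at hn1
  have h1 : (m : ℚ_[p]) / ((p ^ k * n : ℕ) : ℚ_[p]) - x =
      (m - (p : ℚ_[p]) ^ k * x * n) / ((p : ℚ_[p]) ^ k * n) := by
    push_cast
    field_simp
  have h2 : ‖(m : ℚ_[p]) / ((p ^ k * n : ℕ) : ℚ_[p]) - x‖ =
      ‖(m : ℚ_[p]) - (p : ℚ_[p]) ^ k * x * n‖ * (p : ℝ) ^ k := by
    rw [h1, norm_div, norm_mul, hn1, mul_one, norm_pow, Padic.norm_p]
    simp
  have h3 : (p : ℝ) ^ (-((N : ℤ) - k)) = (p : ℝ) ^ (-(N : ℤ)) * (p : ℝ) ^ k := by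
    rw [neg_sub, sub_eq_add_neg, zpow_add₀ hp0.ne', zpow_natCast, mul_comm]
  have h4 : ‖((p : ℚ_[p]) ^ k * x - a) * n‖ ≤ (p : ℝ) ^ (-(N : ℤ)) := by
    rwa [norm_mul, hn1, mul_one]
  rw [h2, h3, mul_le_mul_iff_left₀ (by positivity), Int.modEq_comm, Int.modEq_iff_dvd]
  have h5 : ‖(m : ℚ_[p]) - (p : ℚ_[p]) ^ k * x * n‖ ≤ (p : ℝ) ^ (-(N : ℤ)) ↔
      ‖((m - a * n : ℤ) : ℚ_[p])‖ ≤ (p : ℝ) ^ (-(N : ℤ)) := by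
    constructor
    · intro h
      have e : ((m - a * n : ℤ) : ℚ_[p]) = ((m : ℚ_[p]) - (p : ℚ_[p]) ^ k * x * n) +
          ((p : ℚ_[p]) ^ k * x - a) * n := by
        push_cast
        ring
      rw [e]
      exact (Padic.nonarchimedean _ _).trans (max_le h h4)
    · intro h
      have e : (m : ℚ_[p]) - (p : ℚ_[p]) ^ k * x * n = ((m - a * n : ℤ) : ℚ_[p]) +
          -(((p : ℚ_[p]) ^ k * x - a) * n) := by
        push_cast
        ring
      rw [e]
      exact (Padic.nonarchimedean _ _).trans (max_le h (by rwa [norm_neg]))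
  rw [h5, Padic.norm_int_le_pow_iff_dvd]
  push_cast
  rfl

theorem exists_den_eq_of_norm_eq (p : ℕ) [hp : Fact p.Prime] (k : ℕ) (hk : 0 < k) (r : ℚ)
    (hr : ‖(r : ℚ_[p])‖ = (p : ℝ) ^ k) : ∃ n, r.den = p ^ k * n ∧ ¬ p ∣ n := by
  have hp1 : (1 : ℝ) < p := by exact_mod_cast hp.out.one_lt
  have hp0 : (0 : ℝ) < p := by linarith
  have h1 : ‖(r : ℚ_[p])‖ = ‖(r.num : ℚ_[p])‖ / ‖(r.den : ℚ_[p])‖ := by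
    rw [← norm_div]
    congr 1
    exact_mod_cast congrArg (Rat.cast : ℚ → ℚ_[p]) r.num_div_den.symm
  have hlt : (1 : ℝ) < (p : ℝ) ^ k := one_lt_pow₀ hp1 hk.ne'
  have hden : p ∣ r.den := by
    by_contra h
    have h2 : ‖(r.den : ℚ_[p])‖ = 1 :=
      Padic.norm_natCast_eq_one_iff.2 ((Nat.Prime.coprime_iff_not_dvd hp.out).2 h)
    rw [h2, div_one] at h1
    have := Padic.norm_int_le_one (p := p) r.num
    linarith
  have hnum : ‖(r.num : ℚ_[p])‖ = 1 := by
    rw [Padic.norm_intCast_eq_one_iff, Int.isCoprime_iff_gcd_eq_one]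
    exact r.reduced.coprime_dvd_right hden
  have hden0 : (r.den : ℚ_[p]) ≠ 0 := by exact_mod_cast r.den_ne_zero
  have hd : ‖(r.den : ℚ_[p])‖ = (p : ℝ) ^ (-(k : ℤ)) := by
    rw [h1, hnum] at hr
    rw [zpow_neg, zpow_natCast, ← hr]
    simp
  have hdvd : p ^ k ∣ r.den := by
    have := (Padic.norm_int_le_pow_iff_dvd (p := p) r.den k).1 (by exact_mod_cast hd.le)
    exact_mod_cast this
  obtain ⟨n, hn⟩ := hdvd
  refine ⟨n, hn, ?_⟩
  rw [← Nat.Prime.coprime_iff_not_dvd hp.out, ← Padic.norm_natCast_eq_one_iff]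
  rw [hn] at hd
  push_cast at hd
  rw [norm_mul, norm_pow, Padic.norm_p, zpow_neg, zpow_natCast, inv_pow] at hd
  exact (mul_eq_left₀ (by positivity)).1 hd

theorem mem_ball_iff_exists_den_eq (p : ℕ) [hp : Fact p.Prime] (x : ℚ_[p]) (k N a : ℕ)
    (hk : 0 < k) (hN : 0 < N) (hx : ‖x‖ = (p : ℝ) ^ k)
    (ha : ‖(p : ℚ_[p]) ^ k * x - a‖ ≤ (p : ℝ) ^ (-(N : ℤ))) (r : ℚ) :
    ‖(r : ℚ_[p]) - x‖ ≤ (p : ℝ) ^ (-((N : ℤ) - k)) ↔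
      ∃ n, r.den = p ^ k * n ∧ ¬ p ∣ n ∧ r.num ≡ a * n [ZMOD (p ^ N : ℕ)] := by
  have hp1 : (1 : ℝ) < p := by exact_mod_cast hp.out.one_lt
  have hcast : (r : ℚ_[p]) = (r.num : ℚ_[p]) / ((r.den : ℕ) : ℚ_[p]) := by
    exact_mod_cast congrArg (Rat.cast : ℚ → ℚ_[p]) r.num_div_den.symm
  constructor
  · intro h
    have hlt : ‖(r : ℚ_[p]) - x‖ < ‖x‖ := by
      refine h.trans_lt ?_
      rw [hx, ← zpow_natCast]
      exact zpow_lt_zpow_right₀ hp1 (by omega)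
    have hr : ‖(r : ℚ_[p])‖ = (p : ℝ) ^ k := by
      have := Padic.add_eq_max_of_ne (p := p) hlt.ne
      rw [sub_add_cancel, max_eq_right hlt.le, hx] at this
      exact this
    obtain ⟨n, hn, hpn⟩ := exists_den_eq_of_norm_eq p k hk r hr
    refine ⟨n, hn, hpn, ?_⟩
    rw [hcast, hn] at h
    exact (norm_div_sub_le_iff p x k N a ha r.num n hpn).1 h
  · rintro ⟨n, hn, hpn, h⟩
    rw [hcast, hn]
    exact (norm_div_sub_le_iff p x k N a ha r.num n hpn).2 h

theorem exists_nat_norm_sub_le (p : ℕ) [hp : Fact p.Prime] (u : ℚ_[p]) (hu : ‖u‖ = 1) (N : ℕ)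
    (hN : 0 < N) : ∃ a : ℕ, ¬ p ∣ a ∧ ‖u - a‖ ≤ (p : ℝ) ^ (-(N : ℤ)) := by
  have hp1 : (1 : ℝ) < p := by exact_mod_cast hp.out.one_lt
  have h := PadicInt.appr_spec N (⟨u, hu.le⟩ : ℤ_[p])
  rw [← PadicInt.norm_le_pow_iff_mem_span_pow, PadicInt.norm_def] at h
  refine ⟨_, ?_, h⟩
  rw [← Nat.Prime.coprime_iff_not_dvd hp.out, ← Padic.norm_natCast_eq_one_iff]
  set a := PadicInt.appr (⟨u, hu.le⟩ : ℤ_[p]) N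
  have hlt : ‖u - a‖ < ‖u‖ := by
    refine h.trans_lt ?_
    rw [hu, ← zpow_zero (p : ℝ)]
    exact zpow_lt_zpow_right₀ hp1 (by omega)
  rw [norm_sub_rev] at hlt
  have := Padic.add_eq_max_of_ne (p := p) hlt.ne
  rwa [sub_add_cancel, max_eq_right hlt.le, hu] at this

/-- The proportion of rationals in a ball of radius `p^{k - N}` about a point of norm `pᵏ`. -/
theorem tendsto_ball_height_measure (p : ℕ) [hp : Fact p.Prime] (x : ℚ_[p]) (k N : ℕ)
    (hk : 0 < k) (hN : 0 < N) (hx : ‖x‖ = (p : ℝ) ^ k) :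
    Tendsto (fun T : ℕ =>
        (Nat.card {r : ℚ // ratHeight r ≤ T ∧
          ‖(r : ℚ_[p]) - x‖ ≤ (p : ℝ) ^ (-((N : ℤ) - k))} : ℝ) /
        (Nat.card {r : ℚ // ratHeight r ≤ T} : ℝ)) atTop
      (𝓝 ((p : ℝ) / ((p : ℝ) ^ (k + N) * (p + 1)))) := by
  have hp1 : (1 : ℝ) < p := by exact_mod_cast hp.out.one_lt
  have hp0 : (0 : ℝ) < p := by linarith
  have hu : ‖(p : ℚ_[p]) ^ k * x‖ = 1 := by
    rw [norm_mul, norm_pow, Padic.norm_p, hx, inv_pow]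
    exact inv_mul_cancel₀ (by positivity)
  obtain ⟨a, hpa, ha⟩ := exists_nat_norm_sub_le p _ hu N hN
  have hpq : p ∣ p ^ N := dvd_pow_self p hN.ne'
  have hcop : ∀ (m : ℤ) (n : ℕ), (¬ p ∣ n ∧ m ≡ a * n [ZMOD (p ^ N : ℕ)]) → m.gcd n = 1 →
      m.gcd ((p ^ k * n : ℕ) : ℤ) = 1 := by
    rintro m n ⟨hn, hm⟩ hg
    have hpm : ¬ (p : ℤ) ∣ m := by
      intro h
      have h1 : (p : ℤ) ∣ a * n :=
        (hm.of_dvd (Int.natCast_dvd_natCast.2 hpq)).dvd_iff.1 h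
      have h2 : p ∣ a * n := by exact_mod_cast h1
      exact ((Nat.Prime.dvd_mul hp.out).1 h2).elim hpa hn
    have h1 : Nat.Coprime m.natAbs p := by
      rw [Nat.coprime_comm, Nat.Prime.coprime_iff_not_dvd hp.out, ← Int.natCast_dvd]
      exact hpm
    exact (h1.pow_right k).mul_right hg
  have hnum : ∀ T : ℕ, Nat.card {r : ℚ // ratHeight r ≤ T ∧
      ‖(r : ℚ_[p]) - x‖ ≤ (p : ℝ) ^ (-((N : ℤ) - k))} =
      (boxFilter (fun m n => (¬ p ∣ n ∧ m ≡ a * n [ZMOD (p ^ N : ℕ)]) ∧ m.gcd n = 1)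
        (p ^ k) T).card := fun T =>
    card_ratHeight_le _ _ (p ^ k) T (pow_pos hp.out.pos k)
      (mem_ball_iff_exists_den_eq p x k N a hk hN hx ha) hcop
  have hden : ∀ T : ℕ, Nat.card {r : ℚ // ratHeight r ≤ T} =
      (boxFilter (fun m n => True ∧ m.gcd n = 1) 1 T).card := by
    intro T
    have h := card_ratHeight_le (fun _ => True) (fun _ _ => True) 1 T one_pos
      (fun r => by simp) (fun m n _ h => by simpa using h)
    simpa only [and_true] using h
  have hscale : ∀ d : ℕ, 0 < d → ∀ (m : ℤ) (n : ℕ),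
      (¬ p ∣ d * n ∧ (d : ℤ) * m ≡ a * (d * n : ℕ) [ZMOD (p ^ N : ℕ)]) ↔
      ¬ p ∣ d ∧ ¬ p ∣ n ∧ m ≡ a * n [ZMOD (p ^ N : ℕ)] := by
    intro d _ m n
    rw [Nat.Prime.dvd_mul hp.out, not_or, and_assoc]
    refine and_congr_right fun hd => and_congr_right fun _ => ?_
    have e : (a : ℤ) * (d * n : ℕ) = d * (a * n) := by
      push_cast
      ring
    have hg : Int.gcd ((p ^ N : ℕ) : ℤ) d = 1 :=
      Nat.Coprime.pow_left N ((Nat.Prime.coprime_iff_not_dvd hp.out).2 hd)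
    rw [e]
    refine ⟨fun h => ?_, fun h => h.mul_left _⟩
    have h' := h.cancel_left_div_gcd (by exact_mod_cast pow_pos hp.out.pos N)
    rwa [hg, Nat.cast_one, Int.ediv_one] at h'
  have hA := tendsto_card_boxFilter_coprime _ (p ^ k) (fun d => ¬ p ∣ d) hscale _
    (tendsto_card_boxFilter_modEq p (p ^ k) (p ^ N) (pow_pos hp.out.pos N) a)
  have hB := tendsto_card_boxFilter_coprime (fun _ _ => True) 1 (fun _ => True)
    (fun d _ m n => by simp) 2 tendsto_card_boxFilter_true
  simp only [if_true] at hB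
  have hS := tsum_moebius_div_sq_ne_zero
  have hAB := hA.div hB (mul_ne_zero two_ne_zero hS)
  rw [tsum_moebius_div_sq_eq p hp.out] at hS hAB
  have hS' := right_ne_zero_of_mul hS
  have hlim : ∀ S : ℝ, S ≠ 0 → ((((p ^ k : ℕ) : ℝ)⁻¹ - ((p ^ k * p : ℕ) : ℝ)⁻¹) *
      (2 / ((p ^ N : ℕ) : ℝ)) * S) / (2 * ((1 - 1 / (p : ℝ) ^ 2) * S)) =
      (p : ℝ) / ((p : ℝ) ^ (k + N) * (p + 1)) := by
    intro S hS
    have h1 : (p : ℝ) ^ 2 - 1 ≠ 0 := by nlinarith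
    have h2 : (p : ℝ) + 1 ≠ 0 := by positivity
    have h3 : 1 - 1 / (p : ℝ) ^ 2 = ((p : ℝ) ^ 2 - 1) / (p : ℝ) ^ 2 := by field_simp
    rw [h3]
    push_cast
    rw [pow_add]
    field_simp
    ring
  rw [hlim _ hS'] at hAB
  refine hAB.congr' ?_
  filter_upwards [eventually_gt_atTop 0] with T hT
  have hTne : (T : ℝ) ≠ 0 := by exact_mod_cast hT.ne'
  simp only [Pi.div_apply]
  rw [hnum, hden, div_div_div_cancel_right₀ (pow_ne_zero 2 hTne)]

/-- For a prime `p`, a nonzero `x ∈ ℚ_p` with `v_p(x) < 0` and `e ∈ ℤ` with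
`e > v_p(x)`, the proportion of rationals of height at most `T` lying in the
closed ball `B(x, p^{-e})` tends to `p^{1 + 2 v_p(x) - e}/(p+1)`. -/
theorem ball_height_measure_of_gt_val_neg
    (p : ℕ) [hp : Fact p.Prime] (x : ℚ_[p]) (hx : x ≠ 0) (e : ℤ)
    (hvx : x.valuation < 0) (he : x.valuation < e) :
    Filter.Tendsto
      (fun T : ℕ =>
        (Nat.card {r : ℚ // ratHeight r ≤ T ∧ ‖(r : ℚ_[p]) - x‖ ≤ (p : ℝ) ^ (-e)} : ℝ) /
        (Nat.card {r : ℚ // ratHeight r ≤ T} : ℝ))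
      Filter.atTop (nhds ((p : ℝ) ^ (1 + 2 * x.valuation - e) / ((p : ℝ) + 1))) := by
  obtain ⟨k, hk⟩ : ∃ k : ℕ, x.valuation = -(k : ℤ) := ⟨x.valuation.natAbs, by omega⟩
  obtain ⟨N, hN⟩ : ∃ N : ℕ, e = (N : ℤ) - k := ⟨(e + k).toNat, by omega⟩
  have hp0 : (p : ℝ) ≠ 0 := by exact_mod_cast hp.out.ne_zero
  have hnorm : ‖x‖ = (p : ℝ) ^ k := by
    rw [Padic.norm_eq_zpow_neg_valuation hx, hk, neg_neg, zpow_natCast]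
  have h := tendsto_ball_height_measure p x k N (by omega) (by omega) hnorm
  have hexp : (p : ℝ) ^ (1 + 2 * x.valuation - e) / ((p : ℝ) + 1) =
      (p : ℝ) / ((p : ℝ) ^ (k + N) * (p + 1)) := by
    have h1 : 1 + 2 * x.valuation - e = 1 - ((k + N : ℕ) : ℤ) := by
      push_cast
      omega
    rw [h1, zpow_sub₀ hp0, zpow_one, zpow_natCast, div_div]
  rw [hexp, hN]
  exact h
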